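/- Let k be a field finitely generated over ℚ and f : 𝔸² → 𝔸¹ a morphism over k such that the induced map k × k → k on rational points is surjective outside a finite set. Then the generic fiber of f is geometrically irreducible; equivalently, k(𝔸¹) is algebraically closed in k(𝔸²). -/

import Mathlib

/-!
Statement 19 (from §4 of Bresciani, "A higher dimensional Hilbert irreducibility
theorem").

Let `k` be a field finitely generated over `ℚ` and `f : 𝔸² → 𝔸¹` a morphism over `k`
(given by a polynomial `p ∈ k[x,y]`) such that the induced map `k × k → k` on
rational points is surjective outside a finite set.  Then the generic fiber of `f`
is geometrically irreducible; equivalently, `k(𝔸¹)` is algebraically closed in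
`k(𝔸²)`.

We express both (equivalent) conclusions: geometric irreducibility of the generic
fiber of `Spec k[x,y] ⟶ Spec k[t]`, `t ↦ p`, and that every element of
`k(x,y) = Frac k[x,y]` which is algebraic over the subfield `k(p)` (the copy of
`k(𝔸¹)` embedded via `f`) already lies in it.
-/

noncomputable section
open AlgebraicGeometry CategoryTheory CategoryTheory.Limits TopologicalSpace

universe u
namespace Paper

/-- `Spec k`, as a scheme. -/
abbrev SpecF (k : Type u) [CommRing k] : Scheme.{u} := Spec (CommRingCat.of k)

/-- A field of characteristic `0` is finitely generated over `ℚ` if it is a finitely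
generated field extension of its prime field `ℚ`. -/
def IsFGOverQ (k : Type u) [Field k] [Algebra ℚ k] : Prop :=
  ∃ s : Finset k, IntermediateField.adjoin ℚ (s : Set k) = ⊤

/-- `Spec k̄ ⟶ Spec k` for an algebraic closure `k̄` of `k`. -/
abbrev algClosureMap (k : Type u) [Field k] : SpecF (AlgebraicClosure k) ⟶ SpecF k :=
  Spec.map (CommRingCat.ofHom (algebraMap k (AlgebraicClosure k)))

/-- The base change `X ×_{Spec k} Spec k̄` of `X/k` to the algebraic closure. -/
def baseChangeClosure {k : Type u} [Field k] {X : Scheme.{u}} (st : X ⟶ SpecF k) :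
    Scheme.{u} :=
  pullback st (algClosureMap k)

/-- `X/k` is geometrically irreducible. -/
def IsGeomIrreducibleOver {k : Type u} [Field k] {X : Scheme.{u}} (st : X ⟶ SpecF k) :
    Prop :=
  IrreducibleSpace (baseChangeClosure st)

/-- The generic fiber of `f : X ⟶ C`, `C` irreducible: the base change of `f` along
`Spec k(C) ⟶ C`. -/
def genericFiber {C X : Scheme.{u}} [IrreducibleSpace C] (f : X ⟶ C) : Scheme.{u} :=
  pullback f (C.fromSpecStalk (genericPoint C))

/-- The structure morphism of the generic fiber, over the function field `k(C)`. -/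
def genericFiberSt {C X : Scheme.{u}} [IrreducibleSpace C] (f : X ⟶ C) :
    genericFiber f ⟶ SpecF (C.functionField) :=
  pullback.snd f (C.fromSpecStalk (genericPoint C))

variable (k : Type u) [Field k]

instance : IsDomain (CommRingCat.of (Polynomial k)) :=
  inferInstanceAs (IsDomain (Polynomial k))

/-- The affine plane `𝔸²_k`. -/
abbrev A2 : Scheme.{u} := Spec (CommRingCat.of (MvPolynomial (Fin 2) k))

/-- The affine line `𝔸¹_k`. -/
abbrev A1 : Scheme.{u} := Spec (CommRingCat.of (Polynomial k))

variable {k}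

/-- The morphism `𝔸² ⟶ 𝔸¹` over `k` associated to a polynomial `p ∈ k[x,y]`. -/
def polyMorphism (p : MvPolynomial (Fin 2) k) : A2 k ⟶ A1 k :=
  Spec.map (CommRingCat.ofHom (Polynomial.aeval p).toRingHom)

/-- The map `k × k → k` induced on rational points by a polynomial `p ∈ k[x,y]`. -/
def polyMap (p : MvPolynomial (Fin 2) k) : k × k → k :=
  fun v => MvPolynomial.eval ![v.1, v.2] p

/-- The function field `k(𝔸²) = k(x,y)`. -/
abbrev K2 (k : Type u) [Field k] : Type u := FractionRing (MvPolynomial (Fin 2) k)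

/-- The copy of `k(𝔸¹)` inside `k(𝔸²)`, i.e. the subfield `k(p)` generated over `k`
by the image of `p` under `f`. -/
def genSubfield (p : MvPolynomial (Fin 2) k) : IntermediateField k (K2 k) :=
  IntermediateField.adjoin k {algebraMap (MvPolynomial (Fin 2) k) (K2 k) p}

section Aux

theorem isAlgebraic_of_bot {F K : Type*} [Field F] [Field K] [Algebra F K]
    (_ : Algebra.IsAlgebraic (⊥ : IntermediateField F K) K) : Algebra.IsAlgebraic F K := by
  have : Algebra.IsAlgebraic F (⊥ : IntermediateField F K) := Algebra.IsAlgebraic.of_finite _ _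
  exact Algebra.IsAlgebraic.trans F (⊥ : IntermediateField F K) K

open WithZero in
/-- Existence of a discrete valuation from a Dedekind domain. -/
theorem exists_val_of_dedekind (k : Type u) [Field k] [Algebra ℚ k] (hk : IsFGOverQ k)
    (A : Type*) [CommRing A] [IsDedekindDomain A] (hA : ¬ IsField A) [Algebra A k]
    (hinj : Function.Injective (algebraMap A k)) [Algebra.IsAlgebraic A k] :
    ∃ (v : Valuation k ℤᵐ⁰) (τ : k), v τ = exp (1 : ℤ) := by
  have : FaithfulSMul A k := (faithfulSMul_iff_algebraMap_injective A k).2 hinj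
  let : Algebra (FractionRing A) k := FractionRing.liftAlgebra A k
  have : IsScalarTower A (FractionRing A) k := inferInstance
  have hchar : CharZero k := algebraRat.charZero k
  have : CharZero (FractionRing A) :=
    (RingHom.charZero_iff (algebraMap (FractionRing A) k).injective).2 hchar
  have halg : Algebra.IsAlgebraic (FractionRing A) k := 
    (IsFractionRing.comap_isAlgebraic_iff (A := A) (K := FractionRing A) (C := k)).1 inferInstance
  obtain ⟨s, hs⟩ := hk
  have htop : IntermediateField.adjoin (FractionRing A) (s : Set k) = ⊤ := by
    have h1 : IntermediateField.adjoin ℚ (s : Set k) ≤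
        (IntermediateField.adjoin (FractionRing A) (s : Set k)).restrictScalars ℚ := by
      rw [IntermediateField.adjoin_le_iff]
      exact IntermediateField.subset_adjoin _ _
    rw [hs] at h1
    rw [eq_top_iff]
    intro x _
    exact h1 (IntermediateField.mem_top (F := ℚ) (x := x))
  have hfin : FiniteDimensional (FractionRing A) k := by
    have := IntermediateField.finiteDimensional_adjoin (K := FractionRing A) (L := k)
      (S := (s : Set k)) (fun x _ => (halg.isAlgebraic x).isIntegral)
    rw [htop] at this
    exact (IntermediateField.topEquiv (F := FractionRing A) (E := k)).toLinearEquiv.finiteDimensional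
  let C := integralClosure A k
  have hded : IsDedekindDomain C := integralClosure.isDedekindDomain A (FractionRing A) k
  have hfrac : IsFractionRing C k :=
    IsIntegralClosure.isFractionRing_of_finite_extension A (FractionRing A) k C
  have hC : ¬ IsField C := by
    intro h
    apply hA
    have hi : Algebra.IsIntegral A C := IsIntegralClosure.isIntegral_algebra A k
    exact (hi.isField_iff_isField (by
      intro a b hab
      exact hinj (congrArg Subtype.val hab))).mpr h
  obtain ⟨M, hM0, hM⟩ := Ring.not_isField_iff_exists_prime.mp hC
  let w : IsDedekindDomain.HeightOneSpectrum C := ⟨M, hM, hM0⟩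
  obtain ⟨τ, hτ⟩ := w.valuation_surjective k (exp (1:ℤ))
  exact ⟨w.valuation k, τ, hτ⟩

open WithZero in
theorem exists_val (k : Type u) [Field k] [Algebra ℚ k] (hk : IsFGOverQ k) :
    ∃ (v : Valuation k ℤᵐ⁰) (τ : k), v τ = exp (1 : ℤ) := by
  classical
  have hchar : CharZero k := algebraRat.charZero k
  by_cases halg : Algebra.IsAlgebraic ℚ k
  · have : Algebra.IsAlgebraic ℤ k :=
      (IsFractionRing.comap_isAlgebraic_iff (A := ℤ) (K := ℚ) (C := k)).2 halg
    exact exists_val_of_dedekind k hk ℤ Int.not_isField Int.cast_injective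
  · obtain ⟨s, hs⟩ := id hk
    let P : Finset k → Prop := fun t => ¬ Algebra.IsAlgebraic (IntermediateField.adjoin ℚ (t : Set k)) k
    have hne : (s.powerset.filter P).Nonempty := by
      refine ⟨∅, ?_⟩
      simp only [Finset.mem_filter, Finset.mem_powerset, Finset.empty_subset, true_and, P]
      intro h
      apply halg
      rw [Finset.coe_empty, IntermediateField.adjoin_empty] at h
      exact isAlgebraic_of_bot h
    obtain ⟨t, ht, htmax⟩ := Finset.exists_max_image _ Finset.card hne
    simp only [Finset.mem_filter, Finset.mem_powerset, P] at ht htmax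
    let E := IntermediateField.adjoin ℚ (t : Set k)
    have : ∃ x ∈ s, ¬ IsAlgebraic E x := by
      by_contra! hcon
      apply ht.2
      have h1 : IntermediateField.adjoin ℚ (s : Set k) ≤
          (algebraicClosure E k).restrictScalars ℚ := by
        rw [IntermediateField.adjoin_le_iff]
        intro x hx
        exact mem_algebraicClosure_iff.2 (hcon x hx)
      rw [hs] at h1
      exact ⟨fun x => mem_algebraicClosure_iff.1 (h1 (IntermediateField.mem_top (F := ℚ) (x := x)))⟩
    obtain ⟨x, hxs, hx⟩ := this
    have hxt : x ∉ t := fun h => hx (isAlgebraic_algebraMap (⟨x, IntermediateField.subset_adjoin _ _ h⟩ : E))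
    have halg' : Algebra.IsAlgebraic (IntermediateField.adjoin ℚ ((insert x t : Finset k) : Set k)) k := by
      by_contra hcon
      have := htmax (insert x t) ⟨Finset.insert_subset hxs ht.1, hcon⟩
      rw [Finset.card_insert_of_notMem hxt] at this
      omega
    let : Algebra (Polynomial E) k := (Polynomial.aeval x).toAlgebra
    have hinj : Function.Injective (algebraMap (Polynomial E) k) :=
      transcendental_iff_injective.1 hx
    have : FaithfulSMul (Polynomial E) k := (faithfulSMul_iff_algebraMap_injective _ k).2 hinj
    let : Algebra (FractionRing (Polynomial E)) k := FractionRing.liftAlgebra (Polynomial E) k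
    have : IsScalarTower (Polynomial E) (FractionRing (Polynomial E)) k := inferInstance
    let G := algebraicClosure (FractionRing (Polynomial E)) k
    have hmemE : ∀ y : E, (y : k) ∈ G := fun y => by
      have : (y : k) = algebraMap (FractionRing (Polynomial E)) k (algebraMap (Polynomial E) _ (Polynomial.C y)) := by
        rw [← IsScalarTower.algebraMap_apply]
        exact (Polynomial.aeval_C x y).symm
      rw [this]
      exact G.algebraMap_mem _
    have hmemx : x ∈ G := by
      have : x = algebraMap (FractionRing (Polynomial E)) k (algebraMap (Polynomial E) _ Polynomial.X) := by
        rw [← IsScalarTower.algebraMap_apply]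
        exact (Polynomial.aeval_X x).symm
      rw [this]
      exact G.algebraMap_mem _
    have h1 : IntermediateField.adjoin ℚ ((insert x t : Finset k) : Set k) ≤
        G.restrictScalars ℚ := by
      rw [IntermediateField.adjoin_le_iff]
      intro y hy
      rcases Finset.mem_insert.1 (Finset.mem_coe.1 hy) with rfl | hy
      · exact hmemx
      · exact hmemE ⟨y, IntermediateField.subset_adjoin _ _ hy⟩
    have : Algebra.IsAlgebraic (Polynomial E) k := by
      have hG : Algebra.IsAlgebraic G k := by
        refine ⟨fun z => ?_⟩
        exact IsAlgebraic.ringHom_of_comp_eq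
          ({ toFun := fun y => ⟨y.1, h1 y.2⟩, map_one' := rfl, map_mul' := fun _ _ => rfl,
             map_zero' := rfl, map_add' := fun _ _ => rfl } :
            IntermediateField.adjoin ℚ ((insert x t : Finset k) : Set k) →+* G) (RingHom.id k)
          (halg'.isAlgebraic z) (RingHom.injective _) rfl
      have : Algebra.IsAlgebraic (FractionRing (Polynomial E)) k :=
        Algebra.IsAlgebraic.trans _ G k
      exact (IsFractionRing.comap_isAlgebraic_iff (A := Polynomial E) (K := FractionRing (Polynomial E)) (C := k)).2 this
    exact exists_val_of_dedekind k hk (Polynomial E) (Polynomial.not_isField E) hinj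


theorem exists_val_ext {k K Γ : Type*} [Field k] [Field K] [Algebra k K]
    [LinearOrderedCommGroupWithZero Γ] (v : Valuation k Γ) :
    ∃ V : ValuationSubring K, (V.valuation.comap (algebraMap k K)).IsEquiv v := by
  obtain ⟨V, h, hloc⟩ := IsLocalRing.exists_factor_valuationRing (R := v.valuationSubring)
    ((algebraMap k K).comp v.valuationSubring.subtype)
  refine ⟨V, Valuation.isEquiv_iff_val_le_one.2 fun {c} => ?_⟩
  rw [Valuation.comap_apply, ValuationSubring.valuation_le_one_iff]
  constructor
  · intro hc
    by_contra hlt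
    push Not at hlt
    have hc0 : c ≠ 0 := by rintro rfl; simp at hlt
    have h1 : v c⁻¹ ≤ 1 := by
      rw [map_inv₀]; exact inv_le_one_of_one_le₀ hlt.le
    have hu := hloc.map_nonunit (⟨c⁻¹, h1⟩ : v.valuationSubring) (by
      refine IsUnit.of_mul_eq_one (⟨algebraMap k K c, hc⟩ : V.toSubring) ?_
      apply Subtype.ext
      change algebraMap k K c⁻¹ * algebraMap k K c = 1
      rw [← map_mul, inv_mul_cancel₀ hc0, map_one])
    obtain ⟨d, hd⟩ := hu.exists_right_inv
    have hd' : c⁻¹ * (d : k) = 1 := congrArg Subtype.val hd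
    have : (d : k) = c := by field_simp at hd'; exact hd'
    have h2 : v (d : k) ≤ 1 := d.2
    rw [this] at h2
    exact absurd h2 (not_le.2 hlt)
  · intro hc
    exact h ⟨c, hc⟩

open WithZero Polynomial

theorem val_bdd {k : Type*} [Field k] (v : Valuation k ℤᵐ⁰) (τ : k) (hτ : v τ = exp (1 : ℤ))
    (s : Finset k) : ∃ N : ℕ, ∀ M, N ≤ M → ∀ x ∈ s, v x ≤ v τ ^ M := by
  refine ⟨s.sup fun x => (log (v x)).toNat, fun M hM x hx => ?_⟩
  have h1 : (log (v x)).toNat ≤ M := (Finset.le_sup (f := fun x => (log (v x)).toNat) hx).trans hM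
  by_cases h0 : v x = 0
  · rw [h0]; exact zero_le
  rw [hτ, ← exp_nsmul, ← exp_log h0, exp_le_exp]
  simp
  omega

theorem val_leading {k K Γ : Type*} [Field k] [Field K] [Algebra k K]
    [LinearOrderedCommGroupWithZero Γ] (w : Valuation K Γ) (q : k[X]) (hq : q ≠ 0) (ξ : K) (β : Γ)
    (hβ : ∀ i < q.natDegree, w (algebraMap k K (q.coeff i / q.leadingCoeff)) ≤ β)
    (h1 : 1 ≤ w ξ) (hξ : β < w ξ) :
    w (aeval ξ q) = w (algebraMap k K q.leadingCoeff) * w ξ ^ q.natDegree := by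
  have hl : q.leadingCoeff ≠ 0 := leadingCoeff_ne_zero.2 hq
  have hl' : w (algebraMap k K q.leadingCoeff) ≠ 0 := by simpa using hq
  have hξ0 : w ξ ≠ 0 := fun h => by simp [h] at h1
  have hlast : w (q.leadingCoeff • ξ ^ q.natDegree) =
      w (algebraMap k K q.leadingCoeff) * w ξ ^ q.natDegree := by
    rw [Algebra.smul_def, map_mul, map_pow]
  rw [aeval_eq_sum_range, Finset.sum_range_succ, Valuation.map_add_eq_of_lt_right]
  · exact hlast
  · refine (Valuation.map_sum_lt _ (g := w (algebraMap k K q.leadingCoeff) * w ξ ^ q.natDegree) ?_ ?_).trans_eq hlast.symm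
    · exact mul_ne_zero hl' (pow_ne_zero _ hξ0)
    · intro i hi
      rw [Finset.mem_range] at hi
      have h2 : q.coeff i = q.leadingCoeff * (q.coeff i / q.leadingCoeff) := by field_simp
      rw [h2, Algebra.smul_def, map_mul, map_mul, map_mul, map_pow, mul_assoc]
      refine mul_lt_mul_of_pos_left ?_ (zero_lt_iff.2 hl')
      calc _ ≤ β * w ξ ^ i := by gcongr; exact hβ i hi
        _ < w ξ * w ξ ^ i := by
          refine mul_lt_mul_of_pos_right hξ (zero_lt_iff.2 (pow_ne_zero _ hξ0))
        _ = w ξ ^ (i + 1) := by rw [pow_succ']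
        _ ≤ _ := pow_le_pow_right₀ h1 hi

theorem val_upper {k K Γ : Type*} [Field k] [Field K] [Algebra k K]
    [LinearOrderedCommGroupWithZero Γ] (w : Valuation K Γ) (q : k[X]) (ξ : K) (β γ : Γ)
    (hβ : ∀ i ≤ q.natDegree, w (algebraMap k K (q.coeff i)) ≤ β)
    (h1 : 1 ≤ γ) (hξ : w ξ ≤ γ) :
    w (aeval ξ q) ≤ β * γ ^ q.natDegree := by
  rw [aeval_eq_sum_range]
  refine Valuation.map_sum_le _ fun i hi => ?_
  rw [Finset.mem_range] at hi
  rw [Algebra.smul_def, map_mul, map_pow]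
  refine mul_le_mul' (hβ i (by omega)) ?_
  exact (pow_le_pow_left₀ zero_le hξ i).trans (pow_le_pow_right₀ h1 (by omega))

theorem val_combine {k K Γ : Type*} [Field k] [Field K] [Algebra k K]
    [LinearOrderedCommGroupWithZero Γ] (w : Valuation K Γ) {a b c d : k} {ξ : K} {m n : ℕ}
    (e1 : w (algebraMap k K a) = w (algebraMap k K c) * w ξ ^ m)
    (e2 : w (algebraMap k K b) = w (algebraMap k K d) * w ξ ^ n) :
    w (algebraMap k K (a ^ n * d ^ m)) = w (algebraMap k K (b ^ m * c ^ n)) := by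
  simp only [map_mul, map_pow, e1, e2, mul_pow, ← pow_mul]
  rw [mul_comm m n]
  exact (mul_comm _ _).trans ((congrArg _ (mul_comm _ _)).trans (mul_assoc _ _ _).symm)

theorem natDegree_dvd_of_points {k : Type u} [Field k] (v : Valuation k ℤᵐ⁰) (τ : k)
    (hτ : v τ = exp (1 : ℤ)) (P Z : k[X]) (T : Finset k) (hP : P ≠ 0) (hZ : Z ≠ 0)
    (h : ∀ a, a ∉ T → ∃ (b : k) (K : Type u) (_ : Field K) (_ : Algebra k K) (ξ : K),
      aeval ξ P = algebraMap k K a ∧ aeval ξ Z = algebraMap k K b) :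
    P.natDegree ∣ Z.natDegree := by
  classical
  obtain ⟨N₁, hN₁⟩ := val_bdd v τ hτ
    ((Finset.range (P.natDegree + 1)).image (fun i => P.coeff i / P.leadingCoeff) ∪
      ((Finset.range (Z.natDegree + 1)).image (fun i => Z.coeff i / Z.leadingCoeff) ∪
      ((Finset.range (P.natDegree + 1)).image P.coeff ∪ T)))
  have H1 : ∀ i ≤ P.natDegree, v (P.coeff i / P.leadingCoeff) ≤ v τ ^ N₁ := fun i hi =>
    hN₁ _ le_rfl _ (Finset.mem_union_left _ (Finset.mem_image_of_mem _ (by simp; omega)))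
  have H2 : ∀ i ≤ Z.natDegree, v (Z.coeff i / Z.leadingCoeff) ≤ v τ ^ N₁ := fun i hi =>
    hN₁ _ le_rfl _ (Finset.mem_union_right _ (Finset.mem_union_left _
      (Finset.mem_image_of_mem (fun i => Z.coeff i / Z.leadingCoeff) (by simp; omega))))
  have H3 : ∀ i ≤ P.natDegree, v (P.coeff i) ≤ v τ ^ N₁ := fun i hi =>
    hN₁ _ le_rfl _ (Finset.mem_union_right _ (Finset.mem_union_right _ (Finset.mem_union_left _
      (Finset.mem_image_of_mem _ (by simp; omega)))))
  have H4 : ∀ x ∈ T, v x ≤ v τ ^ N₁ := fun x hx =>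
    hN₁ _ le_rfl _ (Finset.mem_union_right _ (Finset.mem_union_right _
      (Finset.mem_union_right _ hx)))
  have hτ1 : 1 < v τ := by rw [hτ, ← exp_zero, exp_lt_exp]; norm_num
  have hτ0 : v τ ≠ 0 := (zero_lt_one.trans hτ1).ne'
  have key : ∀ M : ℕ, N₁ + N₁ * P.natDegree < M → ∃ c : ℤ,
      (Z.natDegree : ℤ) * M + P.natDegree * log (v Z.leadingCoeff) =
        P.natDegree * c + Z.natDegree * log (v P.leadingCoeff) := by
    intro M hM
    have hT : τ ^ M ∉ T := fun hx => by
      have := H4 _ hx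
      rw [map_pow, pow_le_pow_iff_right₀ hτ1] at this
      have := Nat.zero_le (N₁ * P.natDegree)
      omega
    obtain ⟨b, K, _, _, ξ, hP', hZ'⟩ := h _ hT
    obtain ⟨V, hV⟩ := exists_val_ext (K := K) v
    set w := V.valuation with hw
    have hle : ∀ x y : k, w (algebraMap k K x) ≤ w (algebraMap k K y) ↔ v x ≤ v y := fun x y => hV x y
    have hwτ1 : 1 ≤ w (algebraMap k K τ) := by
      have := (hle 1 τ).2 (by simpa using hτ1.le)
      simpa using this
    have hlt : w (algebraMap k K τ) ^ N₁ < w ξ := by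
      by_contra hcon
      push Not at hcon
      have := val_upper w P ξ (w (algebraMap k K τ) ^ N₁) (w (algebraMap k K τ) ^ N₁)
        (fun i hi => by
          have := (hle (P.coeff i) (τ ^ N₁)).2 (by simpa using H3 i hi)
          simpa using this) (one_le_pow₀ hwτ1) hcon
      rw [hP', ← pow_mul, ← pow_add] at this
      simp only [← map_pow] at this
      rw [hle, map_pow, map_pow, pow_le_pow_iff_right₀ hτ1] at this
      omega
    have hξ1 : 1 ≤ w ξ := (one_le_pow₀ hwτ1).trans hlt.le
    have hξ0 : w ξ ≠ 0 := fun h => by simp [h] at hξ1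
    have e1 := val_leading w P hP ξ (w (algebraMap k K τ) ^ N₁) (fun i hi => by
          have := (hle (P.coeff i / P.leadingCoeff) (τ ^ N₁)).2 (by simpa using H1 i hi.le)
          simpa only [map_pow] using this) hξ1 hlt
    have e2 := val_leading w Z hZ ξ (w (algebraMap k K τ) ^ N₁) (fun i hi => by
          have := (hle (Z.coeff i / Z.leadingCoeff) (τ ^ N₁)).2 (by simpa using H2 i hi.le)
          simpa only [map_pow] using this) hξ1 hlt
    rw [hP'] at e1
    rw [hZ'] at e2
    have hlZ : Z.leadingCoeff ≠ 0 := leadingCoeff_ne_zero.2 hZ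
    have hlP : P.leadingCoeff ≠ 0 := leadingCoeff_ne_zero.2 hP
    have hb : b ≠ 0 := by
      rintro rfl
      rw [map_zero, map_zero] at e2
      have : w (algebraMap k K Z.leadingCoeff) ≠ 0 := by simpa using hZ
      exact mul_ne_zero this (pow_ne_zero _ hξ0) e2.symm
    have e3 : w (algebraMap k K ((τ ^ M) ^ Z.natDegree * Z.leadingCoeff ^ P.natDegree)) =
        w (algebraMap k K (b ^ P.natDegree * P.leadingCoeff ^ Z.natDegree)) := by
      exact val_combine w e1 e2
    have e4 : v ((τ ^ M) ^ Z.natDegree * Z.leadingCoeff ^ P.natDegree) =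
        v (b ^ P.natDegree * P.leadingCoeff ^ Z.natDegree) :=
      le_antisymm ((hle _ _).1 e3.le) ((hle _ _).1 e3.ge)
    have e5 := congrArg log e4
    simp only [map_mul, map_pow] at e5
    have hv : ∀ x : k, x ≠ 0 → v x ≠ 0 := fun x hx => (Valuation.ne_zero_iff v).2 hx
    rw [log_mul (pow_ne_zero _ (pow_ne_zero _ hτ0)) (pow_ne_zero _ (hv _ hlZ)),
      log_mul (pow_ne_zero _ (hv _ hb)) (pow_ne_zero _ (hv _ hlP))] at e5
    simp only [log_pow, hτ, log_exp, nsmul_eq_mul] at e5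
    refine ⟨log (v b), ?_⟩
    rw [← e5]
    ring
  obtain ⟨c₁, h₁⟩ := key (N₁ + N₁ * P.natDegree + 1) (by omega)
  obtain ⟨c₂, h₂⟩ := key (N₁ + N₁ * P.natDegree + 2) (by omega)
  rw [← Int.natCast_dvd_natCast]
  refine ⟨c₂ - c₁, ?_⟩
  push_cast at h₁ h₂
  linarith


theorem eq_zero_of_restrict_eq_zero {k S : Type u} [Field k] [CommRing S] [IsDomain S] [Algebra k S]
    (ρ : S →ₐ[k] k[X]) (p : S) (hp : (ρ p).natDegree ≠ 0) (z : S)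
    (hz : IsIntegral (Algebra.adjoin k {p}) z) (h0 : ρ z = 0) : z = 0 := by
  by_contra hne
  obtain ⟨⟨a, ha⟩, ha0, w, hw⟩ := hz.isAlgebraic.exists_nonzero_dvd
    (mem_nonZeroDivisors_of_ne_zero hne)
  change a = z * w at hw
  have h1 : ρ a = 0 := by rw [hw, map_mul, h0, zero_mul]
  rw [Algebra.adjoin_singleton_eq_range_aeval] at ha
  obtain ⟨q, rfl⟩ := ha
  have h2 : aeval (ρ p) q = 0 := by
    rw [aeval_algHom_apply]; exact h1
  have htr : Transcendental k (ρ p) := Polynomial.transcendental _ hp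
    (mem_nonZeroDivisors_of_ne_zero (leadingCoeff_ne_zero.2 (by rintro h; simp [h] at hp)))
  have := (transcendental_iff.1 htr) q h2
  apply ha0
  apply Subtype.ext
  simp [this]

theorem exists_lift_point {k S : Type u} [Field k] [CommRing S] [IsDomain S] [Algebra k S]
    (ρ : S →ₐ[k] k[X]) (p : S) (hp : (ρ p).natDegree ≠ 0) (ev : S →ₐ[k] k) :
    ∃ (K : Type u) (_ : Field K) (_ : Algebra k K) (ξ : K),
      ∀ z, IsIntegral (Algebra.adjoin k {p}) z → aeval ξ (ρ z) = algebraMap k K (ev z) := by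
  let R : Subalgebra k S := (integralClosure (Algebra.adjoin k {p}) S).restrictScalars k
  let g : R →ₐ[k] k[X] := ρ.comp R.val
  let e : R →ₐ[k] k := ev.comp R.val
  let : Algebra R k[X] := g.toRingHom.toAlgebra
  have hpR : p ∈ R := (isIntegral_algebraMap
    (x := (⟨p, Algebra.self_mem_adjoin_singleton k p⟩ : Algebra.adjoin k {p})) :
      IsIntegral (Algebra.adjoin k {p}) p)
  have : IsScalarTower k R k[X] := IsScalarTower.of_algebraMap_eq fun x => by
    change _ = g (algebraMap k R x)
    rw [AlgHom.commutes]
  have hinj : Function.Injective (algebraMap R k[X]) := by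
    rw [injective_iff_map_eq_zero]
    intro a ha
    exact Subtype.ext (eq_zero_of_restrict_eq_zero ρ p hp a.1 a.2 ha)
  have hX : IsIntegral R (X : k[X]) := by
    let q : R[X] := (ρ p).map (algebraMap k R) - C ⟨p, hpR⟩
    have hl : (ρ p).leadingCoeff ≠ 0 := leadingCoeff_ne_zero.2 (by rintro h; simp [h] at hp)
    let q' : R[X] := C (algebraMap k R (ρ p).leadingCoeff⁻¹) * q
    have hR : Function.Injective (algebraMap k R) := (algebraMap k R).injective
    refine ⟨q', ?_, ?_⟩
    · have hd : ((ρ p).map (algebraMap k R)).natDegree = (ρ p).natDegree := natDegree_map_eq_of_injective hR _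
      have hq : q.leadingCoeff = algebraMap k R (ρ p).leadingCoeff := by
        have : q.natDegree = (ρ p).natDegree := by
          rw [natDegree_sub_C, hd]
        rw [leadingCoeff, this, coeff_sub, coeff_map, coeff_C, if_neg hp, sub_zero]
        rfl
      change q'.leadingCoeff = 1
      rw [leadingCoeff_mul, leadingCoeff_C, hq, ← map_mul, inv_mul_cancel₀ hl, map_one]
    · change eval₂ (algebraMap R k[X]) X q' = 0
      have : eval₂ (algebraMap R k[X]) X q = 0 := by
        rw [eval₂_sub, eval₂_C, eval₂_map, ← IsScalarTower.algebraMap_eq]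
        have h1 : eval₂ (algebraMap k k[X]) X (ρ p) = ρ p := by
          rw [← aeval_def, aeval_X_left_apply]
        rw [h1]
        exact sub_self _
      rw [eval₂_mul, this, mul_zero]
  have hInteg : Algebra.IsIntegral R k[X] := by
    refine ⟨fun f => ?_⟩
    induction f using Polynomial.induction_on' with
    | add a b ha hb => exact ha.add hb
    | monomial n a =>
      rw [← C_mul_X_pow_eq_monomial]
      refine IsIntegral.mul ?_ (hX.pow n)
      have : (C a : k[X]) = algebraMap R k[X] (algebraMap k R a) := by
        rw [← IsScalarTower.algebraMap_apply]; rfl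
      rw [this]
      exact isIntegral_algebraMap
  have hmax : (RingHom.ker e.toRingHom).IsMaximal :=
    RingHom.ker_isMaximal_of_surjective _ (fun c => ⟨algebraMap k R c, e.commutes c⟩)
  obtain ⟨Q, hQ, hQc⟩ := Ideal.exists_ideal_over_maximal_of_isIntegral (S := k[X])
    (RingHom.ker e.toRingHom) (by rw [(RingHom.injective_iff_ker_eq_bot _).1 hinj]; exact bot_le)
  refine ⟨k[X] ⧸ Q, Ideal.Quotient.field Q, inferInstance, Ideal.Quotient.mk Q X, fun z hz => ?_⟩
  have h1 : (⟨z, hz⟩ - algebraMap k R (ev z) : R) ∈ RingHom.ker e.toRingHom := by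
    change e _ = 0
    rw [map_sub, AlgHom.commutes]
    exact sub_self _
  rw [← hQc, Ideal.mem_comap, map_sub, ← IsScalarTower.algebraMap_apply] at h1
  have h2 := (Ideal.Quotient.eq).2 h1
  have h3 : ∀ f : k[X], aeval (Ideal.Quotient.mk Q X) f = Ideal.Quotient.mk Q f := fun f => by
    have := aeval_algHom_apply (Ideal.Quotient.mkₐ k Q) X f
    rw [aeval_X_left_apply] at this
    exact this
  rw [h3]
  exact h2

theorem aeval_eq_eval' {k σ : Type*} [Field k] (f : σ → k) (p : MvPolynomial σ k) :
    MvPolynomial.aeval f p = MvPolynomial.eval f p :=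
  DFunLike.congr_fun (MvPolynomial.coe_aeval_eq_eval f) p

theorem mem_adjoin_of_isIntegral {k : Type u} [Field k] [Infinite k] (v : Valuation k ℤᵐ⁰) (τ : k)
    (hτ : v τ = exp (1 : ℤ)) (p : MvPolynomial (Fin 2) k)
    (hsurj : ∃ T : Finset k, ∀ a : k, a ∉ T → ∃ v : k × k, polyMap p v = a)
    (z : MvPolynomial (Fin 2) k) (hz : IsIntegral (Algebra.adjoin k {p}) z) :
    z ∈ Algebra.adjoin k {p} := by
  classical
  obtain ⟨T, hT⟩ := hsurj
  obtain ⟨a, ha⟩ := Infinite.exists_notMem_finset T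
  obtain ⟨b, hb⟩ := Infinite.exists_notMem_finset (insert a T)
  rw [Finset.mem_insert, not_or] at hb
  obtain ⟨A, hA⟩ := hT a ha
  obtain ⟨B, hB⟩ := hT b hb.2
  let ρ : MvPolynomial (Fin 2) k →ₐ[k] k[X] := MvPolynomial.aeval
    (fun i => C (![A.1, A.2] i) + X * C (![B.1, B.2] i - ![A.1, A.2] i))
  have h0 : (ρ p).eval 0 = a := by
    rw [← hA, polyMap, ← aeval_eq_eval', ← Polynomial.coe_aeval_eq_eval]
    change ((aeval (0:k)).comp ρ) p = _
    refine DFunLike.congr_fun (MvPolynomial.algHom_ext fun i => ?_) p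
    simp [ρ]
  have h1 : (ρ p).eval 1 = b := by
    rw [← hB, polyMap, ← aeval_eq_eval', ← Polynomial.coe_aeval_eq_eval]
    change ((aeval (1:k)).comp ρ) p = _
    refine DFunLike.congr_fun (MvPolynomial.algHom_ext fun i => ?_) p
    simp [ρ]
  have hp : (ρ p).natDegree ≠ 0 := by
    intro h
    rw [eq_C_of_natDegree_eq_zero h] at h0 h1
    rw [eval_C] at h0 h1
    exact hb.1 (h1.symm.trans h0)
  have hp0 : ρ p ≠ 0 := by rintro h; simp [h] at hp
  have hdvd : ∀ z, IsIntegral (Algebra.adjoin k {p}) z → ρ z ≠ 0 →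
      (ρ p).natDegree ∣ (ρ z).natDegree := by
    intro z hz hz0
    refine natDegree_dvd_of_points v τ hτ (ρ p) (ρ z) T hp0 hz0 fun a ha => ?_
    obtain ⟨u, hu⟩ := hT a ha
    obtain ⟨K, i1, i2, ξ, hξ⟩ := exists_lift_point ρ p hp (MvPolynomial.aeval ![u.1, u.2])
    refine ⟨MvPolynomial.aeval ![u.1, u.2] z, K, i1, i2, ξ, ?_, hξ z hz⟩
    rw [hξ p (isIntegral_algebraMap
      (x := (⟨p, Algebra.self_mem_adjoin_singleton k p⟩ : Algebra.adjoin k {p}))), ← hu, polyMap, aeval_eq_eval']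
  induction hn : (ρ z).natDegree using Nat.strong_induction_on generalizing z with
  | _ n ih =>
    by_cases hz0 : ρ z = 0
    · rw [eq_zero_of_restrict_eq_zero ρ p hp z hz hz0]
      exact zero_mem _
    obtain ⟨j, hj⟩ := hdvd z hz hz0
    have hlP : (ρ p).leadingCoeff ≠ 0 := leadingCoeff_ne_zero.2 hp0
    have hlZ : (ρ z).leadingCoeff ≠ 0 := leadingCoeff_ne_zero.2 hz0
    let c : k := (ρ z).leadingCoeff / (ρ p).leadingCoeff ^ j
    have hc : c ≠ 0 := div_ne_zero hlZ (pow_ne_zero _ hlP)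
    let y : MvPolynomial (Fin 2) k := algebraMap k _ c * p ^ j
    have hy : y ∈ Algebra.adjoin k {p} :=
      mul_mem (Subalgebra.algebraMap_mem _ _) (pow_mem (Algebra.self_mem_adjoin_singleton k p) _)
    have hρy : ρ y = C c * (ρ p) ^ j := by
      simp only [y, map_mul, map_pow, AlgHom.commutes]; rfl
    have hzy : IsIntegral (Algebra.adjoin k {p}) (z - y) :=
      hz.sub (isIntegral_algebraMap (x := (⟨y, hy⟩ : Algebra.adjoin k {p})))
    have hdeg : (ρ (z - y)).degree < (ρ z).degree := by
      rw [map_sub]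
      refine degree_sub_lt_left ?_ hz0 ?_
      · rw [hρy, degree_C_mul hc, degree_pow, degree_eq_natDegree hz0, degree_eq_natDegree hp0, hj]
        simp [mul_comm]
      · rw [hρy, leadingCoeff_mul, leadingCoeff_C, leadingCoeff_pow]
        simp only [c]
        field_simp
    have hmem : z - y ∈ Algebra.adjoin k {p} := by
      by_cases h0 : ρ (z - y) = 0
      · rw [eq_zero_of_restrict_eq_zero ρ p hp _ hzy h0]
        exact zero_mem _
      · exact ih _ (hn ▸ natDegree_lt_natDegree h0 hdeg) (z - y) hzy rfl
    have := add_mem hmem hy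
    rwa [sub_add_cancel] at this


theorem aeval_injective {k : Type u} [Field k] [Infinite k] (p : MvPolynomial (Fin 2) k)
    (hsurj : ∃ T : Finset k, ∀ a : k, a ∉ T → ∃ v : k × k, polyMap p v = a) :
    Function.Injective (aeval p : k[X] →ₐ[k] MvPolynomial (Fin 2) k) := by
  rw [injective_iff_map_eq_zero]
  intro q hq
  obtain ⟨T, hT⟩ := hsurj
  have hinf : ((T : Set k)ᶜ).Infinite := T.finite_toSet.infinite_compl
  refine q.eq_zero_of_infinite_isRoot (hinf.mono ?_)
  intro a ha
  obtain ⟨w, hw⟩ := hT a (by simpa using ha)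
  have h1 : (MvPolynomial.aeval ![w.1, w.2] : MvPolynomial (Fin 2) k →ₐ[k] k) p = a := by
    rw [← hw]; rfl
  have h2 := congrArg (MvPolynomial.aeval ![w.1, w.2] : MvPolynomial (Fin 2) k →ₐ[k] k) hq
  rw [← aeval_algHom_apply, h1, map_zero] at h2
  simpa [IsRoot] using h2

theorem exists_frac {k : Type u} [Field k] [Infinite k] (v : Valuation k ℤᵐ⁰) (τ : k)
    (hτ : v τ = exp (1 : ℤ)) (p : MvPolynomial (Fin 2) k)
    (hsurj : ∃ T : Finset k, ∀ a : k, a ∉ T → ∃ v : k × k, polyMap p v = a)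
    [Algebra k[X] (MvPolynomial (Fin 2) k)]
    (halg : ∀ q, algebraMap k[X] (MvPolynomial (Fin 2) k) q = aeval p q)
    (z : K2 k) (hz : IsAlgebraic k[X] z) :
    ∃ a b : k[X], algebraMap k[X] (K2 k) b ≠ 0 ∧
      z * algebraMap k[X] (K2 k) b = algebraMap k[X] (K2 k) a := by
  have hinj := aeval_injective p hsurj
  have hinj2 : Function.Injective (algebraMap k[X] (K2 k)) := by
    rw [IsScalarTower.algebraMap_eq k[X] (MvPolynomial (Fin 2) k)]
    refine (IsFractionRing.injective (MvPolynomial (Fin 2) k) (K2 k)).comp ?_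
    intro x y hxy
    exact hinj ((halg x).symm.trans (Eq.trans hxy (halg y)))
  obtain ⟨y, hy0, hy⟩ := hz.exists_integral_multiple
  have hy' : IsIntegral (MvPolynomial (Fin 2) k) (y • z) := hy.tower_top
  obtain ⟨s, hs⟩ := IsIntegrallyClosed.isIntegral_iff.1 hy'
  have hsint : IsIntegral k[X] s := by
    rw [← hs] at hy
    exact (isIntegral_algebraMap_iff
      (IsFractionRing.injective (MvPolynomial (Fin 2) k) (K2 k))).1 hy
  have hs2 : IsIntegral (Algebra.adjoin k {p}) s := by
    obtain ⟨Q, hQ, hQ0⟩ := hsint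
    let φ : k[X] →+* Algebra.adjoin k {p} :=
      ((aeval p).codRestrict (Algebra.adjoin k {p}) (fun q => by
        rw [Algebra.adjoin_singleton_eq_range_aeval]; exact ⟨q, rfl⟩) :
        k[X] →ₐ[k] Algebra.adjoin k {p}).toRingHom
    refine ⟨Q.map φ, hQ.map φ, ?_⟩
    rw [eval₂_map, ← hQ0]
    congr 1
    exact RingHom.ext fun q => (halg q).symm
  have hs3 := mem_adjoin_of_isIntegral v τ hτ p hsurj s hs2
  rw [Algebra.adjoin_singleton_eq_range_aeval] at hs3
  obtain ⟨a, ha⟩ := hs3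
  refine ⟨a, y, ?_, ?_⟩
  · exact fun h => hy0 (hinj2 (by rw [h, map_zero]))
  · rw [mul_comm, ← Algebra.smul_def, ← hs, ← (show aeval p a = s from ha), ← halg,
      ← IsScalarTower.algebraMap_apply]

open scoped IntermediateField.algebraAdjoinAdjoin in
theorem isAlgebraic_algebra_adjoin {F E : Type u} [Field F] [Field E] [Algebra F E] (x z : E)
    (hz : IsAlgebraic (IntermediateField.adjoin F {x}) z) :
    IsAlgebraic (Algebra.adjoin F {x}) z :=
  (IsFractionRing.isAlgebraic_iff (Algebra.adjoin F {x}) (IntermediateField.adjoin F {x}) E).2 hz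

theorem mem_genSubfield {k : Type u} [Field k] [Infinite k] (v : Valuation k ℤᵐ⁰) (τ : k)
    (hτ : v τ = exp (1 : ℤ)) (p : MvPolynomial (Fin 2) k)
    (hsurj : ∃ T : Finset k, ∀ a : k, a ∉ T → ∃ v : k × k, polyMap p v = a)
    (z : K2 k) (hz : IsAlgebraic (genSubfield p) z) : z ∈ genSubfield p := by
  let _ : Algebra k[X] (MvPolynomial (Fin 2) k) := (aeval p).toRingHom.toAlgebra
  have halg : ∀ q, algebraMap k[X] (MvPolynomial (Fin 2) k) q = aeval p q := fun _ => rfl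
  have halg2 : ∀ q : k[X], algebraMap k[X] (K2 k) q =
      aeval (algebraMap (MvPolynomial (Fin 2) k) (K2 k) p) q := by
    intro q
    rw [IsScalarTower.algebraMap_apply k[X] (MvPolynomial (Fin 2) k) (K2 k), halg,
      aeval_algebraMap_apply]
  have hmem : ∀ q : k[X], algebraMap k[X] (K2 k) q ∈ Algebra.adjoin k
      {algebraMap (MvPolynomial (Fin 2) k) (K2 k) p} := by
    intro q
    rw [halg2, Algebra.adjoin_singleton_eq_range_aeval]
    exact ⟨q, rfl⟩
  have hz1 : IsAlgebraic (Algebra.adjoin k {algebraMap (MvPolynomial (Fin 2) k) (K2 k) p}) z :=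
    isAlgebraic_algebra_adjoin _ z hz
  let φ : k[X] →ₐ[k] Algebra.adjoin k {algebraMap (MvPolynomial (Fin 2) k) (K2 k) p} :=
      ((aeval (algebraMap (MvPolynomial (Fin 2) k) (K2 k) p)).codRestrict _ (fun q => by
        rw [Algebra.adjoin_singleton_eq_range_aeval]; exact ⟨q, rfl⟩))
  have hz2 : IsAlgebraic k[X] z := by
    refine IsAlgebraic.of_ringHom_of_comp_eq φ (RingHom.id (K2 k)) hz1 ?_
      Function.injective_id ?_
    · rintro ⟨x, hx⟩
      have hx' := hx
      rw [Algebra.adjoin_singleton_eq_range_aeval] at hx'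
      obtain ⟨q, hq⟩ := hx'
      exact ⟨q, Subtype.ext hq⟩
    · exact RingHom.ext fun q => (halg2 q).symm
  obtain ⟨a, b, hb, hab⟩ := exists_frac v τ hτ p hsurj halg z hz2
  rw [← eq_div_iff hb] at hab
  rw [hab]
  exact div_mem (IntermediateField.algebra_adjoin_le_adjoin _ _ (hmem a))
    (IntermediateField.algebra_adjoin_le_adjoin _ _ (hmem b))

theorem linearDisjoint_of_algClosed {K M : Type u} [Field K] [CharZero K] [Field M] [Algebra K M]
    (A E : IntermediateField K M)
    (hA : ∀ z ∈ A, IsIntegral K z → z ∈ (algebraMap K M).range)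
    [FiniteDimensional K E] : A.LinearDisjoint E := by
  let pb := Field.powerBasisOfFiniteOfSeparable K E
  let θ : M := (pb.gen : M)
  have hInteg : IsIntegral K θ := (Algebra.IsIntegral.isIntegral (R := K) pb.gen).map E.val
  have hIntegA : IsIntegral A θ := hInteg.tower_top
  have hmin : minpoly K θ = minpoly K pb.gen :=
    minpoly.algebraMap_eq (B := E) (B' := M) Subtype.val_injective pb.gen
  have hdvd : minpoly A θ ∣ (minpoly K θ).map (algebraMap K A) :=
    minpoly.dvd_map_of_isScalarTower K A θ
  have hcoeff := isIntegral_coeff_of_dvd (minpoly K θ) (minpoly A θ) (minpoly.monic hInteg)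
    (minpoly.monic hIntegA) hdvd
  have hlift : minpoly A θ ∈ lifts (algebraMap K A) := by
    rw [lifts_iff_coeff_lifts]
    intro n
    obtain ⟨c, hc⟩ := hA _ ((minpoly A θ).coeff n).2 ((hcoeff n).map A.val)
    exact ⟨c, Subtype.ext hc⟩
  obtain ⟨q, hq, hqdeg, hqm⟩ := lifts_and_natDegree_eq_and_monic hlift (minpoly.monic hIntegA)
  have hle : (minpoly K θ).natDegree ≤ q.natDegree := by
    refine natDegree_le_of_dvd (minpoly.dvd K θ ?_) hqm.ne_zero
    rw [← aeval_map_algebraMap A, hq, minpoly.aeval]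
  have hdim : pb.dim ≤ (minpoly A θ).natDegree := by
    rw [← hqdeg, ← pb.natDegree_minpoly, ← hmin]
    exact hle
  refine IntermediateField.LinearDisjoint.of_basis_right pb.basis ?_
  have h := (linearIndependent_pow (K := A) θ).comp (Fin.castLE hdim) (Fin.castLE_injective hdim)
  have he : (E.val ∘ pb.basis : Fin pb.dim → M) =
      (fun i : Fin (minpoly A θ).natDegree => θ ^ (i : ℕ)) ∘ Fin.castLE hdim := by
    ext i
    simp [θ]
  rw [he]
  exact h

theorem isDomain_tensor {K L Kb : Type u} [Field K] [CharZero K] [Field L] [Algebra K L]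
    [Field Kb] [Algebra K Kb] [Algebra.IsAlgebraic K Kb]
    (hL : ∀ z : L, IsAlgebraic K z → z ∈ (algebraMap K L).range) :
    IsDomain (TensorProduct K L Kb) := by
  let M := AlgebraicClosure L
  let fa : L →ₐ[K] M := IsScalarTower.toAlgHom K L M
  let fb : Kb →ₐ[K] M := IsAlgClosed.lift
  refine Subalgebra.LinearDisjoint.isDomain_of_injective fa.injective fb.injective ?_
  have : Algebra.IsIntegral K fb.range :=
    (AlgEquiv.ofInjective fb fb.injective).isIntegral_iff.1 inferInstance
  refine Subalgebra.LinearDisjoint.of_linearDisjoint_finite_right _ _ fun B' hB' _ => ?_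
  have hf : IsField B' := isField_of_isIntegral_of_isField' (Field.toIsField K)
  let E : IntermediateField K M := B'.toIntermediateField' hf
  have : FiniteDimensional K E := ‹Module.Finite K B'›
  have := linearDisjoint_of_algClosed fa.fieldRange E ?_
  · exact IntermediateField.linearDisjoint_iff'.1 this
  · rintro _ ⟨z, rfl⟩ hz
    obtain ⟨c, hc⟩ := hL z ((isIntegral_algHom_iff fa fa.injective).1 hz).isAlgebraic
    refine ⟨c, ?_⟩
    change _ = fa z
    rw [← hc, AlgHom.commutes]

theorem isDomain_baseChange {A B F L Fb : Type u} [CommRing A] [IsDomain A] [CommRing B] [Field F]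
    [CharZero F] [Field L] [Field Fb] [Algebra A B] [Algebra A F] [IsFractionRing A F]
    [Algebra B L] [Algebra A L] [IsScalarTower A B L] [Algebra F L] [IsScalarTower A F L]
    [Algebra F Fb] [Algebra A Fb] [IsScalarTower A F Fb] [Algebra.IsAlgebraic F Fb]
    (hBL : Function.Injective (algebraMap B L))
    (hL : ∀ z : L, IsAlgebraic F z → z ∈ (algebraMap F L).range) :
    IsDomain (TensorProduct A B Fb) := by
  have hd : IsDomain (TensorProduct F L Fb) := isDomain_tensor hL
  have hd2 : IsDomain (TensorProduct A L Fb) :=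
    (IsLocalization.algebraTensorEquiv (nonZeroDivisors A) F L Fb).symm.toMulEquiv.isDomain
  have hflat1 : Module.Flat A F := IsLocalization.flat F (nonZeroDivisors A)
  have hflat : Module.Flat A Fb := Module.Flat.trans A F Fb
  let f : TensorProduct A B Fb →ₐ[A] TensorProduct A L Fb :=
    Algebra.TensorProduct.map (IsScalarTower.toAlgHom A B L) (AlgHom.id A Fb)
  have hf : Function.Injective f := by
    have := Module.Flat.rTensor_preserves_injective_linearMap (M := Fb)
      (IsScalarTower.toAlgHom A B L).toLinearMap hBL
    exact this
  exact hf.isDomain f.toRingHom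

theorem irreducible_of_isDomain {A B F : Type u} [CommRing A] [CommRing B] [Field F]
    [Algebra A B] [Algebra A F] [IsDomain (TensorProduct A B (AlgebraicClosure F))]
    (f : SpecF B ⟶ SpecF A) (g : SpecF F ⟶ SpecF A)
    (hf : f = Spec.map (CommRingCat.ofHom (algebraMap A B)))
    (hg : g = Spec.map (CommRingCat.ofHom (algebraMap A F))) :
    IsGeomIrreducibleOver (pullback.snd f g) := by
  unfold IsGeomIrreducibleOver baseChangeClosure
  rw [(pullbackLeftPullbackSndIso f g (algClosureMap F)).hom.homeomorph.irreducibleSpace_iff]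
  have h : algClosureMap F ≫ g =
      Spec.map (CommRingCat.ofHom (algebraMap A (AlgebraicClosure F))) := by
    rw [hg, ← Spec.map_comp, ← CommRingCat.ofHom_comp, ← IsScalarTower.algebraMap_eq]
  rw [(pullback.congrHom hf h).hom.homeomorph.irreducibleSpace_iff,
    (pullbackSpecIso A B (AlgebraicClosure F)).hom.homeomorph.irreducibleSpace_iff]
  exact inferInstanceAs (IrreducibleSpace (PrimeSpectrum (TensorProduct A B (AlgebraicClosure F))))


theorem geom_part {k : Type u} [Field k] [CharZero k] (p : MvPolynomial (Fin 2) k)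
    (hinj : Function.Injective (aeval p : k[X] →ₐ[k] MvPolynomial (Fin 2) k))
    [Algebra k[X] (MvPolynomial (Fin 2) k)]
    (halg : ∀ q, algebraMap k[X] (MvPolynomial (Fin 2) k) q = aeval p q)
    (hfrac : ∀ z : K2 k, IsAlgebraic k[X] z → ∃ a b : k[X], algebraMap k[X] (K2 k) b ≠ 0 ∧
      z * algebraMap k[X] (K2 k) b = algebraMap k[X] (K2 k) a) :
    IsGeomIrreducibleOver (genericFiberSt (polyMorphism p)) := by
  let _ : Algebra k[X] (A1 k).functionField :=
    AlgebraicGeometry.instAlgebraCarrierFunctionFieldSpec (CommRingCat.of k[X])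
  have hfr : IsFractionRing k[X] (A1 k).functionField :=
    functionField_isFractionRing_of_affine (CommRingCat.of k[X])
  have hinj2 : Function.Injective (algebraMap k[X] (K2 k)) := by
    rw [IsScalarTower.algebraMap_eq k[X] (MvPolynomial (Fin 2) k)]
    refine (IsFractionRing.injective (MvPolynomial (Fin 2) k) (K2 k)).comp ?_
    intro x y hxy
    exact hinj ((halg x).symm.trans (Eq.trans hxy (halg y)))
  let _ : Algebra (A1 k).functionField (K2 k) := (IsFractionRing.lift hinj2).toAlgebra
  have hst : IsScalarTower k[X] (A1 k).functionField (K2 k) :=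
    IsScalarTower.of_algebraMap_eq fun x => (IsFractionRing.lift_algebraMap hinj2 x).symm
  have hcz : CharZero (A1 k).functionField :=
    charZero_of_injective_algebraMap (IsFractionRing.injective k[X] (A1 k).functionField)
  have hL : ∀ z : K2 k, IsAlgebraic (A1 k).functionField z →
      z ∈ (algebraMap (A1 k).functionField (K2 k)).range := by
    intro z hz
    obtain ⟨a, b, hb, hab⟩ := hfrac z
      ((IsFractionRing.isAlgebraic_iff k[X] (A1 k).functionField (K2 k)).2 hz)
    refine ⟨algebraMap k[X] _ a / algebraMap k[X] _ b, ?_⟩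
    rw [map_div₀, ← IsScalarTower.algebraMap_apply, ← IsScalarTower.algebraMap_apply,
      div_eq_iff hb, hab]
  have hd : IsDomain (TensorProduct k[X] (MvPolynomial (Fin 2) k)
      (AlgebraicClosure (A1 k).functionField)) :=
    isDomain_baseChange (F := (A1 k).functionField) (L := K2 k)
      (IsFractionRing.injective (MvPolynomial (Fin 2) k) (K2 k)) hL
  refine irreducible_of_isDomain (A := k[X]) (F := (A1 k).functionField) _ _ ?_ ?_
  · unfold polyMorphism
    congr 2
    exact RingHom.ext fun q => (halg q).symm
  · exact Spec.fromSpecStalk_eq' (CommRingCat.of k[X]) _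

end Aux

theorem generic_fiber_geometrically_irreducible
    (k : Type u) [Field k] [Algebra ℚ k] (hk : IsFGOverQ k)
    (p : MvPolynomial (Fin 2) k)
    (hsurj : ∃ T : Finset k, ∀ a : k, a ∉ T → ∃ v : k × k, polyMap p v = a) :
    IsGeomIrreducibleOver (genericFiberSt (polyMorphism p)) ∧
      ∀ z : K2 k, IsAlgebraic (genSubfield p) z → z ∈ genSubfield p := by
  have hcz : CharZero k := algebraRat.charZero k
  obtain ⟨v, τ, hτ⟩ := exists_val k hk
  refine ⟨?_, fun z hz => mem_genSubfield v τ hτ p hsurj z hz⟩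
  let _ : Algebra (Polynomial k) (MvPolynomial (Fin 2) k) :=
    (Polynomial.aeval p).toRingHom.toAlgebra
  exact geom_part p (aeval_injective p hsurj) (fun _ => rfl)
    (fun z hz => exists_frac v τ hτ p hsurj (fun _ => rfl) z hz)

end Paper
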